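/- arXiv:2502.02273 — 2 statements merged into one kernel-verified Lean document; each statement's English description precedes it below -/
import Mathlib

section
/- Let a < b be real numbers, let β₁, β₂ > −1, and let g : [a, b] → ℝ be continuous. Define h(s) = (s−a)^{β₁} (b−s)^{β₂} g(s) for s ∈ (a, b), and for each positive integer N set λ_j^N = a + j(b−a)/(N+1) for j = 1, …, N. Then for every compact set K ⊆ ℂ ∖ [a, b], the functions λ ↦ ((b−a)/(2πN)) · Σ_{j=1}^{N} h(λ_j^N)/(λ − λ_j^N) converge uniformly on K, as N → ∞, to λ ↦ (1/(2π)) ∫_a^b h(s)/(λ − s) ds. -/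
open MeasureTheory Set Filter

/-- The function `h(s) = (s-a)^{β₁} (b-s)^{β₂} g(s)` with possible power-type
singularities at the endpoints. -/
noncomputable def reflectionDensity (a b β₁ β₂ : ℝ) (g : ℝ → ℝ) (s : ℝ) : ℝ :=
  (s - a) ^ β₁ * (b - s) ^ β₂ * g s

open Topology

/-- The index of the cell of the uniform partition of `(a, b]` into `N + 1` cells that
contains `s`. -/
noncomputable def gridIndex (a b : ℝ) (N : ℕ) (s : ℝ) : ℕ :=
  ⌈(s - a) / ((b - a) / ((N : ℝ) + 1))⌉₊

theorem measurable_gridIndex (a b : ℝ) (N : ℕ) : Measurable (gridIndex a b N) := by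
  unfold gridIndex
  fun_prop

theorem gridIndex_eq {a b s : ℝ} (hab : a < b) {N j : ℕ}
    (h₁ : a + j * (b - a) / ((N : ℝ) + 1) < s)
    (h₂ : s ≤ a + ((j + 1 : ℕ) : ℝ) * (b - a) / ((N : ℝ) + 1)) :
    gridIndex a b N s = j + 1 := by
  have hN : (0 : ℝ) < (N : ℝ) + 1 := by positivity
  have hΔ : 0 < (b - a) / ((N : ℝ) + 1) := div_pos (sub_pos.2 hab) hN
  rw [mul_div_assoc] at h₁ h₂
  rw [gridIndex, Nat.ceil_eq_iff (Nat.succ_ne_zero j), lt_div_iff₀ hΔ, div_le_iff₀ hΔ]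
  constructor
  · rw [Nat.succ_sub_one]; linarith
  · linarith

theorem le_gridPoint {a b s : ℝ} (hab : a < b) (N : ℕ) :
    s ≤ a + gridIndex a b N s * (b - a) / ((N : ℝ) + 1) := by
  have hΔ : 0 < (b - a) / ((N : ℝ) + 1) := div_pos (sub_pos.2 hab) (by positivity)
  have := Nat.le_ceil ((s - a) / ((b - a) / ((N : ℝ) + 1)))
  rw [div_le_iff₀ hΔ] at this
  rw [gridIndex, mul_div_assoc]
  linarith

theorem gridPoint_le {a b s : ℝ} (hab : a < b) (hs : a ≤ s) (N : ℕ) :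
    a + gridIndex a b N s * (b - a) / ((N : ℝ) + 1) ≤ s + (b - a) / ((N : ℝ) + 1) := by
  have hΔ : 0 < (b - a) / ((N : ℝ) + 1) := div_pos (sub_pos.2 hab) (by positivity)
  have := (Nat.ceil_lt_add_one (div_nonneg (sub_nonneg.2 hs) hΔ.le)).le
  rw [← sub_le_iff_le_add, le_div_iff₀ hΔ] at this
  rw [gridIndex, mul_div_assoc]
  linarith

theorem gridPoint_le_sub {a b : ℝ} (hab : a < b) {N j : ℕ} (hj : j ≤ N) :
    a + j * (b - a) / ((N : ℝ) + 1) ≤ b - (b - a) / ((N : ℝ) + 1) := by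
  have hN : (0 : ℝ) < (N : ℝ) + 1 := by positivity
  have hΔ : 0 < (b - a) / ((N : ℝ) + 1) := div_pos (sub_pos.2 hab) hN
  have hb : ((N : ℝ) + 1) * ((b - a) / ((N : ℝ) + 1)) = b - a := by field_simp
  have : (j : ℝ) * ((b - a) / ((N : ℝ) + 1)) ≤ N * ((b - a) / ((N : ℝ) + 1)) := by gcongr
  rw [mul_div_assoc]
  linarith

/-- A function of the cell index integrates to the corresponding equal-weight sum. -/
theorem integral_comp_gridIndex {a b : ℝ} (hab : a < b) (N : ℕ) (G : ℕ → ℂ) :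
    ∫ s in Ioo a b, G (gridIndex a b N s) =
      (((b - a) / ((N : ℝ) + 1) : ℝ) : ℂ) * ∑ j ∈ Finset.Icc 1 (N + 1), G j := by
  have hN : (0 : ℝ) < (N : ℝ) + 1 := by positivity
  have hΔ : 0 < (b - a) / ((N : ℝ) + 1) := div_pos (sub_pos.2 hab) hN
  set p : ℕ → ℝ := fun j => a + j * (b - a) / ((N : ℝ) + 1) with hp
  have hstep (j : ℕ) : p (j + 1) - p j = (b - a) / ((N : ℝ) + 1) := by
    simp only [hp]; push_cast; ring
  have hle (j : ℕ) : p j ≤ p (j + 1) := by linarith [hstep j]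
  have hcell (j : ℕ) : EqOn (fun _ : ℝ => G (j + 1)) (fun s => G (gridIndex a b N s))
      (Set.uIoc (p j) (p (j + 1))) := by
    intro s hs
    rw [Set.uIoc_of_le (hle j)] at hs
    simp only [gridIndex_eq hab hs.1 hs.2]
  have hsum := intervalIntegral.sum_integral_adjacent_intervals (μ := volume) (a := p)
    (n := N + 1) (f := fun s => G (gridIndex a b N s))
    (fun j _ => intervalIntegrable_const.congr (hcell j))
  have h0 : p 0 = a := by simp [hp]
  have h1 : p (N + 1) = b := by simp only [hp]; push_cast; field_simp; ring
  rw [h0, h1, intervalIntegral.integral_of_le hab.le, integral_Ioc_eq_integral_Ioo] at hsum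
  rw [← hsum, Finset.mul_sum, ← Finset.Ico_add_one_right_eq_Icc, Finset.sum_Ico_eq_sum_range]
  refine Finset.sum_congr rfl fun j _ => ?_
  rw [← intervalIntegral.integral_congr_ae (ae_of_all _ (hcell j)),
    intervalIntegral.integral_const, hstep, Complex.real_smul, add_comm 1 j]

theorem rpow_le_rpow_add_rpow {x y L : ℝ} (β : ℝ) (hy : 0 < y) (hyx : y ≤ x) (hxL : x ≤ L) :
    x ^ β ≤ L ^ β + y ^ β := by
  have hx : 0 < x := hy.trans_le hyx
  rcases le_total β 0 with hβ | hβ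
  · have := Real.rpow_le_rpow_of_nonpos hy hyx hβ
    have := Real.rpow_nonneg (hx.le.trans hxL) β
    linarith
  · have := Real.rpow_le_rpow hx.le hxL hβ
    have := Real.rpow_nonneg hy.le β
    linarith

/-- A single integrable function bounds the density at all points `t` that lie to the right of `s`
and no more than twice closer to `b`. -/
theorem exists_integrableOn_bound_reflectionDensity {a b β₁ β₂ : ℝ} {g : ℝ → ℝ}
    (hab : a < b) (hβ₁ : -1 < β₁) (hβ₂ : -1 < β₂) (hg : ContinuousOn g (Icc a b)) :
    ∃ D : ℝ → ℝ, IntegrableOn D (Ioo a b) ∧ ∀ s ∈ Ioo a b, ∀ t, s ≤ t → (b - s) / 2 ≤ b - t →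
      ‖reflectionDensity a b β₁ β₂ g t‖ ≤ D s := by
  obtain ⟨M, hM⟩ := isCompact_Icc.exists_bound_of_continuousOn hg
  have hM0 : 0 ≤ M := (norm_nonneg _).trans (hM a ⟨le_rfl, hab.le⟩)
  have hL : 0 < b - a := sub_pos.2 hab
  refine ⟨fun s => (((b - a) ^ β₁ + (s - a) ^ β₁) * ((b - a) ^ β₂ + ((b - a) / 4) ^ β₂) +
    ((b - a) ^ β₁ + ((b - a) / 2) ^ β₁) * ((b - a) ^ β₂ + (b - s) ^ β₂ * (1 / 2) ^ β₂)) * M,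
    ?_, ?_⟩
  · have i₁ : IntegrableOn (fun s => (s - a) ^ β₁) (Ioo a b) := by
      have := (intervalIntegral.intervalIntegrable_rpow' (a := 0) (b := b - a) hβ₁).comp_sub_right a
      rw [zero_add, sub_add_cancel] at this
      exact (intervalIntegrable_iff_integrableOn_Ioo_of_le hab.le).1 this
    have i₂ : IntegrableOn (fun s => (b - s) ^ β₂) (Ioo a b) := by
      have := (intervalIntegral.intervalIntegrable_rpow' (a := b - a) (b := 0) hβ₂).comp_sub_left b
      rw [sub_zero, sub_sub_cancel] at this
      exact (intervalIntegrable_iff_integrableOn_Ioo_of_le hab.le).1 this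
    have c (x : ℝ) : IntegrableOn (fun _ : ℝ => x) (Ioo a b) := by simp
    exact ((((c _).add i₁).mul_const _).add (((c _).add (i₂.mul_const _)).const_mul _)).mul_const _
  · rintro s ⟨has, hsb⟩ t hst htb
    have hgt : ‖g t‖ ≤ M := hM t ⟨by linarith, by linarith⟩
    have hta := Real.rpow_nonneg (show 0 ≤ t - a by linarith) β₁
    have htb' := Real.rpow_nonneg (show 0 ≤ b - t by linarith) β₂
    have hsa := Real.rpow_nonneg (show 0 ≤ s - a by linarith) β₁
    have hsb' := Real.rpow_nonneg (show 0 ≤ b - s by linarith) β₂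
    have hhalf : (b - s) ^ β₂ * (1 / 2) ^ β₂ = ((b - s) / 2) ^ β₂ := by
      rw [← Real.mul_rpow (by linarith) (by norm_num)]; ring_nf
    rw [reflectionDensity, norm_mul, norm_mul, Real.norm_of_nonneg hta, Real.norm_of_nonneg htb']
    refine mul_le_mul ?_ hgt (norm_nonneg _) (by positivity)
    rcases le_total s ((a + b) / 2) with h | h
    · refine le_add_of_le_of_nonneg (mul_le_mul ?_ ?_ htb' (by positivity)) (by positivity)
      · exact rpow_le_rpow_add_rpow β₁ (by linarith) (by linarith) (by linarith)
      · exact rpow_le_rpow_add_rpow β₂ (by linarith) (by linarith) (by linarith)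
    · refine le_add_of_nonneg_of_le (by positivity) (mul_le_mul ?_ ?_ htb' (by positivity))
      · exact rpow_le_rpow_add_rpow β₁ (by linarith) (by linarith) (by linarith)
      · rw [hhalf]
        exact rpow_le_rpow_add_rpow β₂ (by linarith) (by linarith) (by linarith)

theorem continuousAt_reflectionDensity {a b β₁ β₂ : ℝ} {g : ℝ → ℝ}
    (hg : ContinuousOn g (Icc a b)) {s : ℝ} (hs : s ∈ Ioo a b) :
    ContinuousAt (reflectionDensity a b β₁ β₂ g) s := by
  have h₁ : ContinuousAt (fun s => (s - a) ^ β₁) s :=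
    (continuousAt_id.sub continuousAt_const).rpow_const (Or.inl (sub_pos.2 hs.1).ne')
  have h₂ : ContinuousAt (fun s => (b - s) ^ β₂) s :=
    (continuousAt_const.sub continuousAt_id).rpow_const (Or.inl (sub_pos.2 hs.2).ne')
  exact (h₁.mul h₂).mul (hg.continuousAt (Icc_mem_nhds hs.1 hs.2))

/-- The value, with the weight correction `(N + 1) / N`, that the `N`-point sum assigns to the
`j`-th cell; the last cell has no sample point. -/
noncomputable def sampledDensity (a b β₁ β₂ : ℝ) (g : ℝ → ℝ) (N j : ℕ) : ℝ :=
  if j ≤ N then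
    ((N : ℝ) + 1) / N * reflectionDensity a b β₁ β₂ g (a + j * (b - a) / ((N : ℝ) + 1))
  else 0

theorem tendsto_mesh (a b : ℝ) :
    Tendsto (fun N : ℕ => (b - a) / ((N : ℝ) + 1)) atTop (𝓝 0) :=
  tendsto_const_nhds.div_atTop
    (tendsto_atTop_add_const_right _ _ tendsto_natCast_atTop_atTop)

theorem tendsto_sampledDensity {a b β₁ β₂ : ℝ} {g : ℝ → ℝ} (hab : a < b)
    (hg : ContinuousOn g (Icc a b)) {s : ℝ} (hs : s ∈ Ioo a b) :
    Tendsto (fun N => sampledDensity a b β₁ β₂ g N (gridIndex a b N s)) atTop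
      (𝓝 (reflectionDensity a b β₁ β₂ g s)) := by
  have hpt : Tendsto (fun N : ℕ => a + gridIndex a b N s * (b - a) / ((N : ℝ) + 1)) atTop
      (𝓝 s) := by
    refine tendsto_of_tendsto_of_tendsto_of_le_of_le tendsto_const_nhds
      (by simpa using tendsto_const_nhds.add (tendsto_mesh a b))
      (fun N => le_gridPoint hab N) (fun N => gridPoint_le hab hs.1.le N)
  have hratio : Tendsto (fun N : ℕ => ((N : ℝ) + 1) / N) atTop (𝓝 1) := by
    have : Tendsto (fun N : ℕ => 1 + 1 / (N : ℝ)) atTop (𝓝 (1 + 0)) :=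
      tendsto_const_nhds.add tendsto_one_div_atTop_nhds_zero_nat
    rw [add_zero] at this
    refine this.congr' ?_
    filter_upwards [eventually_ge_atTop 1] with N hN
    have : (N : ℝ) ≠ 0 := by positivity
    field_simp
  have hlim := hratio.mul ((continuousAt_reflectionDensity (β₁ := β₁) (β₂ := β₂) hg hs).tendsto.comp
    hpt)
  rw [one_mul] at hlim
  refine hlim.congr' ?_
  filter_upwards [hpt.eventually_lt_const hs.2] with N hN
  have hidx : gridIndex a b N s ≤ N := by
    by_contra! h
    have h' : (N : ℝ) + 1 ≤ gridIndex a b N s := by exact_mod_cast h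
    have : b - a ≤ gridIndex a b N s * (b - a) / ((N : ℝ) + 1) := by
      rw [le_div_iff₀ (by positivity), mul_comm]
      exact mul_le_mul_of_nonneg_right h' (sub_pos.2 hab).le
    linarith
  simp only [sampledDensity, if_pos hidx, Function.comp]

theorem norm_sampledDensity_le {a b β₁ β₂ : ℝ} {g : ℝ → ℝ} (hab : a < b) {D : ℝ → ℝ}
    (hD : ∀ s ∈ Ioo a b, ∀ t, s ≤ t → (b - s) / 2 ≤ b - t →
      ‖reflectionDensity a b β₁ β₂ g t‖ ≤ D s) {s : ℝ} (hs : s ∈ Ioo a b) (N : ℕ) :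
    ‖sampledDensity a b β₁ β₂ g N (gridIndex a b N s)‖ ≤ 2 * D s := by
  have hD0 : 0 ≤ D s := (norm_nonneg _).trans (hD s hs s le_rfl (by linarith [hs.2]))
  unfold sampledDensity
  split_ifs with hidx
  · rw [norm_mul]
    refine mul_le_mul ?_ (hD s hs _ (le_gridPoint hab N) ?_) (norm_nonneg _) zero_le_two
    · rw [Real.norm_of_nonneg (by positivity)]
      rcases Nat.eq_zero_or_pos N with rfl | hN
      · simp
      · have : (1 : ℝ) ≤ N := by exact_mod_cast hN
        rw [div_le_iff₀ (by positivity)]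
        linarith
    · linarith [gridPoint_le hab hs.1.le N, gridPoint_le_sub hab hidx]
  · simpa using hD0

theorem aestronglyMeasurable_reflectionDensity {a b β₁ β₂ : ℝ} {g : ℝ → ℝ}
    (hg : ContinuousOn g (Icc a b)) :
    AEStronglyMeasurable (reflectionDensity a b β₁ β₂ g) (volume.restrict (Ioo a b)) :=
  ContinuousOn.aestronglyMeasurable
    (fun _ hs => (continuousAt_reflectionDensity hg hs).continuousWithinAt) measurableSet_Ioo

theorem integrableOn_reflectionDensity {a b β₁ β₂ : ℝ} {g : ℝ → ℝ}
    (hab : a < b) (hβ₁ : -1 < β₁) (hβ₂ : -1 < β₂) (hg : ContinuousOn g (Icc a b)) :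
    IntegrableOn (reflectionDensity a b β₁ β₂ g) (Ioo a b) := by
  obtain ⟨D, hDi, hD⟩ := exists_integrableOn_bound_reflectionDensity hab hβ₁ hβ₂ hg
  exact hDi.mono' (aestronglyMeasurable_reflectionDensity hg)
    (ae_restrict_of_forall_mem measurableSet_Ioo
      fun s hs => hD s hs s le_rfl (by linarith [hs.2]))

theorem integrableOn_sampledDensity {a b β₁ β₂ : ℝ} {g : ℝ → ℝ}
    (hab : a < b) (hβ₁ : -1 < β₁) (hβ₂ : -1 < β₂) (hg : ContinuousOn g (Icc a b)) (N : ℕ) :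
    IntegrableOn (fun s => sampledDensity a b β₁ β₂ g N (gridIndex a b N s)) (Ioo a b) := by
  obtain ⟨D, hDi, hD⟩ := exists_integrableOn_bound_reflectionDensity hab hβ₁ hβ₂ hg
  exact (hDi.const_mul 2).mono'
    ((measurable_from_top (f := sampledDensity a b β₁ β₂ g N)).comp
      (measurable_gridIndex a b N)).aestronglyMeasurable
    (ae_restrict_of_forall_mem measurableSet_Ioo fun s hs => norm_sampledDensity_le hab hD hs N)

/-- The sampled step functions converge to the density in `L¹(a, b)`. -/
theorem tendsto_integral_norm_sampledDensity_sub {a b β₁ β₂ : ℝ} {g : ℝ → ℝ}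
    (hab : a < b) (hβ₁ : -1 < β₁) (hβ₂ : -1 < β₂) (hg : ContinuousOn g (Icc a b)) :
    Tendsto (fun N => ∫ s in Ioo a b, ‖sampledDensity a b β₁ β₂ g N (gridIndex a b N s) -
      reflectionDensity a b β₁ β₂ g s‖) atTop (𝓝 0) := by
  obtain ⟨D, hDi, hD⟩ := exists_integrableOn_bound_reflectionDensity hab hβ₁ hβ₂ hg
  rw [show (0 : ℝ) = ∫ _ in Ioo a b, (0 : ℝ) by simp]
  refine tendsto_integral_of_dominated_convergence (fun s => 2 * D s + D s) (fun N => ?_)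
    ((hDi.const_mul 2).add hDi) (fun N => ?_) ?_
  · exact ((integrableOn_sampledDensity hab hβ₁ hβ₂ hg N).sub
      (integrableOn_reflectionDensity hab hβ₁ hβ₂ hg)).norm.aestronglyMeasurable
  · refine ae_restrict_of_forall_mem measurableSet_Ioo fun s hs => ?_
    rw [norm_norm]
    exact (norm_sub_le _ _).trans (add_le_add (norm_sampledDensity_le hab hD hs N)
      (hD s hs s le_rfl (by linarith [hs.2])))
  · refine ae_restrict_of_forall_mem measurableSet_Ioo fun s hs => ?_
    have := (tendsto_sampledDensity (β₁ := β₁) (β₂ := β₂) hab hg hs).sub_const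
      (reflectionDensity a b β₁ β₂ g s)
    simpa using this.norm

theorem norm_div_sub_div_le {d x y : ℝ} {z p q : ℂ} (hd : 0 < d) (hp : d ≤ ‖z - p‖)
    (hq : d ≤ ‖z - q‖) :
    ‖(x : ℂ) / (z - p) - (y : ℂ) / (z - q)‖ ≤ ‖x - y‖ / d + ‖y‖ * (‖p - q‖ / d ^ 2) := by
  have hp0 : z - p ≠ 0 := norm_pos_iff.1 (hd.trans_le hp)
  have hq0 : z - q ≠ 0 := norm_pos_iff.1 (hd.trans_le hq)
  have : (x : ℂ) / (z - p) - (y : ℂ) / (z - q) =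
      ((x - y : ℝ) : ℂ) / (z - p) + (y : ℂ) * ((p - q) / ((z - p) * (z - q))) := by
    push_cast; field_simp; ring
  rw [this]
  refine (norm_add_le _ _).trans (add_le_add ?_ ?_)
  · rw [norm_div, Complex.norm_real]; gcongr
  · rw [norm_mul, norm_div, norm_mul, Complex.norm_real, pow_two]; gcongr

theorem norm_sampled_kernel_sub_le {a b β₁ β₂ : ℝ} {g : ℝ → ℝ} (hab : a < b) {z : ℂ} {d : ℝ}
    (hd : 0 < d) (hz : ∀ s ∈ Icc a b, d ≤ ‖z - (s : ℂ)‖) {s : ℝ} (hs : s ∈ Ioo a b) (N : ℕ) :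
    ‖(sampledDensity a b β₁ β₂ g N (gridIndex a b N s) : ℂ) /
        (z - ((a + gridIndex a b N s * (b - a) / ((N : ℝ) + 1) : ℝ) : ℂ)) -
      (reflectionDensity a b β₁ β₂ g s : ℂ) / (z - (s : ℂ))‖ ≤
    ‖sampledDensity a b β₁ β₂ g N (gridIndex a b N s) - reflectionDensity a b β₁ β₂ g s‖ / d +
      ‖reflectionDensity a b β₁ β₂ g s‖ * ((b - a) / ((N : ℝ) + 1) / d ^ 2) := by
  have hΔ : 0 < (b - a) / ((N : ℝ) + 1) := div_pos (sub_pos.2 hab) (by positivity)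
  have hle := le_gridPoint (s := s) hab N
  have hge := gridPoint_le hab hs.1.le N
  have hsz := hz s (Ioo_subset_Icc_self hs)
  by_cases hidx : gridIndex a b N s ≤ N
  · have hlast := gridPoint_le_sub hab hidx
    refine (norm_div_sub_div_le hd (hz _ ⟨hs.1.le.trans hle, by linarith⟩) hsz).trans ?_
    gcongr
    rw [← Complex.ofReal_sub, Complex.norm_real, Real.norm_of_nonneg (by linarith)]
    linarith
  · simp only [sampledDensity, if_neg hidx, Complex.ofReal_zero, zero_div, zero_sub, norm_neg]
    refine le_add_of_le_of_nonneg ?_ (by positivity)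
    rw [norm_div, Complex.norm_real]
    gcongr

theorem sampled_sum_eq_integral {a b β₁ β₂ : ℝ} {g : ℝ → ℝ} (hab : a < b) {N : ℕ} (hN : 1 ≤ N)
    (z : ℂ) :
    (((b - a) / (2 * Real.pi * N) : ℝ) : ℂ) *
        ∑ j ∈ Finset.Icc 1 N,
          (reflectionDensity a b β₁ β₂ g (a + j * (b - a) / ((N : ℝ) + 1)) : ℂ) /
            (z - ((a + j * (b - a) / ((N : ℝ) + 1) : ℝ) : ℂ)) =
      ((1 / (2 * Real.pi) : ℝ) : ℂ) *
        ∫ s in Ioo a b, (sampledDensity a b β₁ β₂ g N (gridIndex a b N s) : ℂ) /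
          (z - ((a + gridIndex a b N s * (b - a) / ((N : ℝ) + 1) : ℝ) : ℂ)) := by
  rw [integral_comp_gridIndex hab N (fun j => (sampledDensity a b β₁ β₂ g N j : ℂ) /
      (z - ((a + j * (b - a) / ((N : ℝ) + 1) : ℝ) : ℂ))),
    Finset.sum_Icc_succ_top (Nat.le_add_left 1 N)]
  have hlast : sampledDensity a b β₁ β₂ g N (N + 1) = 0 := by simp [sampledDensity]
  rw [hlast, Complex.ofReal_zero, zero_div, add_zero, ← mul_assoc, Finset.mul_sum, Finset.mul_sum]
  refine Finset.sum_congr rfl fun j hj => ?_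
  rw [sampledDensity, if_pos (Finset.mem_Icc.1 hj).2, ← mul_div_assoc, ← mul_div_assoc,
    ← Complex.ofReal_mul, ← Complex.ofReal_mul, ← Complex.ofReal_mul]
  have hN0 : (N : ℝ) ≠ 0 := by positivity
  have hN1 : (N : ℝ) + 1 ≠ 0 := by positivity
  have hpi := Real.pi_ne_zero
  have hw : (b - a) / (2 * Real.pi * N) =
      1 / (2 * Real.pi) * ((b - a) / ((N : ℝ) + 1)) * (((N : ℝ) + 1) / N) := by
    field_simp
  rw [hw, mul_assoc _ (((N : ℝ) + 1) / N)]

theorem integrableOn_kernel {a b β₁ β₂ : ℝ} {g : ℝ → ℝ}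
    (hab : a < b) (hβ₁ : -1 < β₁) (hβ₂ : -1 < β₂) (hg : ContinuousOn g (Icc a b)) {z : ℂ} {d : ℝ}
    (hd : 0 < d) (hz : ∀ s ∈ Icc a b, d ≤ ‖z - (s : ℂ)‖) :
    IntegrableOn (fun s : ℝ => (reflectionDensity a b β₁ β₂ g s : ℂ) / (z - (s : ℂ)))
      (Ioo a b) := by
  have hi := integrableOn_reflectionDensity hab hβ₁ hβ₂ hg
  refine (hi.norm.div_const d).mono' ?_ ?_
  · exact (Complex.continuous_ofReal.comp_aestronglyMeasurable hi.aestronglyMeasurable).div₀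
      (by fun_prop)
  · refine ae_restrict_of_forall_mem measurableSet_Ioo fun s hs => ?_
    rw [norm_div, Complex.norm_real]
    have := hz s (Ioo_subset_Icc_self hs)
    gcongr

theorem integrableOn_sampled_kernel {a b β₁ β₂ : ℝ} {g : ℝ → ℝ}
    (hab : a < b) (hβ₁ : -1 < β₁) (hβ₂ : -1 < β₂) (hg : ContinuousOn g (Icc a b)) {z : ℂ} {d : ℝ}
    (hd : 0 < d) (hz : ∀ s ∈ Icc a b, d ≤ ‖z - (s : ℂ)‖) (N : ℕ) :
    IntegrableOn (fun s => (sampledDensity a b β₁ β₂ g N (gridIndex a b N s) : ℂ) /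
      (z - ((a + gridIndex a b N s * (b - a) / ((N : ℝ) + 1) : ℝ) : ℂ))) (Ioo a b) := by
  have hh := integrableOn_reflectionDensity hab hβ₁ hβ₂ hg
  have hk := integrableOn_kernel hab hβ₁ hβ₂ hg hd hz
  have hsub := ((integrableOn_sampledDensity hab hβ₁ hβ₂ hg N).sub hh).norm.div_const d
  have hrest := hh.norm.mul_const ((b - a) / ((N : ℝ) + 1) / d ^ 2)
  have hmeas : Measurable fun s =>
      (sampledDensity a b β₁ β₂ g N (gridIndex a b N s) : ℂ) /
        (z - ((a + gridIndex a b N s * (b - a) / ((N : ℝ) + 1) : ℝ) : ℂ)) :=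
    (measurable_from_top (f := fun j : ℕ => (sampledDensity a b β₁ β₂ g N j : ℂ) /
      (z - ((a + j * (b - a) / ((N : ℝ) + 1) : ℝ) : ℂ)))).comp (measurable_gridIndex a b N)
  refine ((hsub.add hrest).add hk.norm).mono' hmeas.aestronglyMeasurable
    (ae_restrict_of_forall_mem measurableSet_Ioo fun s hs => ?_)
  exact (norm_le_norm_sub_add _ _).trans
    (add_le_add_left (norm_sampled_kernel_sub_le hab hd hz hs N) _)

theorem cauchy_kernel_sums_converge_uniformly_on_compacts
    (a b β₁ β₂ : ℝ) (g : ℝ → ℝ)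
    (hab : a < b) (hβ₁ : -1 < β₁) (hβ₂ : -1 < β₂)
    (hg : ContinuousOn g (Icc a b)) :
    ∀ K : Set ℂ, IsCompact K → K ⊆ ((fun s : ℝ => (s : ℂ)) '' Icc a b)ᶜ →
      TendstoUniformlyOn
        (fun (N : ℕ) (z : ℂ) =>
          (((b - a) / (2 * Real.pi * N) : ℝ) : ℂ) *
            ∑ j ∈ Finset.Icc 1 N,
              (reflectionDensity a b β₁ β₂ g (a + j * (b - a) / ((N : ℝ) + 1)) : ℂ) /
                (z - ((a + j * (b - a) / ((N : ℝ) + 1) : ℝ) : ℂ)))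
        (fun z : ℂ =>
          ((1 / (2 * Real.pi) : ℝ) : ℂ) *
            ∫ s in Ioo a b, (reflectionDensity a b β₁ β₂ g s : ℂ) / (z - (s : ℂ)))
        atTop K := by
  intro K hK hKab
  obtain ⟨d, hd, hdK⟩ : ∃ d : ℝ, 0 < d ∧ ∀ z ∈ K, ∀ s ∈ Icc a b, d ≤ ‖z - (s : ℂ)‖ := by
    obtain ⟨r, hr, h⟩ := Metric.exists_pos_forall_lt_edist hK
      (isCompact_Icc.image Complex.continuous_ofReal).isClosed
      (disjoint_left.2 fun _ hz => hKab hz)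
    refine ⟨r, hr, fun z hz s hs => ?_⟩
    have := h z hz s (mem_image_of_mem _ hs)
    rw [edist_nndist, ENNReal.coe_lt_coe, ← NNReal.coe_lt_coe, coe_nndist, dist_eq_norm] at this
    exact this.le
  have hh := integrableOn_reflectionDensity hab hβ₁ hβ₂ hg
  have herr : Tendsto (fun N : ℕ => 1 / (2 * Real.pi) *
      ((∫ s in Ioo a b, ‖sampledDensity a b β₁ β₂ g N (gridIndex a b N s) -
          reflectionDensity a b β₁ β₂ g s‖) / d +
        (∫ s in Ioo a b, ‖reflectionDensity a b β₁ β₂ g s‖) * ((b - a) / ((N : ℝ) + 1) / d ^ 2)))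
      atTop (𝓝 0) := by
    simpa using (((tendsto_integral_norm_sampledDensity_sub hab hβ₁ hβ₂ hg).div_const d).add
      (((tendsto_mesh a b).div_const (d ^ 2)).const_mul _)).const_mul (1 / (2 * Real.pi))
  rw [Metric.tendstoUniformlyOn_iff]
  intro ε hε
  filter_upwards [eventually_ge_atTop 1, herr.eventually_lt_const hε] with N hN hNε z hz
  refine lt_of_le_of_lt ?_ hNε
  have hsub : IntegrableOn (fun s => ‖sampledDensity a b β₁ β₂ g N (gridIndex a b N s) -
      reflectionDensity a b β₁ β₂ g s‖ / d) (Ioo a b) :=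
    ((integrableOn_sampledDensity hab hβ₁ hβ₂ hg N).sub hh).norm.div_const d
  have hrest := hh.norm.mul_const ((b - a) / ((N : ℝ) + 1) / d ^ 2)
  rw [dist_comm, dist_eq_norm, sampled_sum_eq_integral hab hN, ← mul_sub,
    ← integral_sub (integrableOn_sampled_kernel hab hβ₁ hβ₂ hg hd (hdK z hz) N)
      (integrableOn_kernel hab hβ₁ hβ₂ hg hd (hdK z hz)),
    norm_mul, Complex.norm_real, Real.norm_of_nonneg (by positivity), ← integral_div,
    ← integral_mul_const, ← integral_add hsub hrest]
  gcongr
  exact norm_integral_le_of_norm_le (hsub.add hrest)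
    (ae_restrict_of_forall_mem measurableSet_Ioo fun s hs =>
      norm_sampled_kernel_sub_le hab hd (hdK z hz) hs N)
end

section
/- With eK(m) = ∫₀^{π/2} (1 − m² sin² y)^{−1/2} dy, eE(m) = ∫₀^{π/2} (1 − m² sin² y)^{1/2} dy, and W(m) = (m²+1)/2 + m²(m²−1)/(m²−1+eE(m)/eK(m)) for m ∈ (0,1), one has lim_{m→1⁻} W(m) = 1. -/
open Real Filter

/-- The complete elliptic integral of the first kind,
`eK(m) = ∫₀^{π/2} (1 - m² sin² y)^{-1/2} dy`. -/
noncomputable def eK (m : ℝ) : ℝ :=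
  ∫ y in (0 : ℝ)..(π / 2), 1 / Real.sqrt (1 - m ^ 2 * Real.sin y ^ 2)

/-- The complete elliptic integral of the second kind,
`eE(m) = ∫₀^{π/2} (1 - m² sin² y)^{1/2} dy`. -/
noncomputable def eE (m : ℝ) : ℝ :=
  ∫ y in (0 : ℝ)..(π / 2), Real.sqrt (1 - m ^ 2 * Real.sin y ^ 2)

/-- The function `W(m) = (m²+1)/2 + m²(m²-1)/(m²-1+eE(m)/eK(m))`. -/
noncomputable def W (m : ℝ) : ℝ :=
  (m ^ 2 + 1) / 2 + m ^ 2 * (m ^ 2 - 1) / (m ^ 2 - 1 + eE m / eK m)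

theorem one_sub_sq_le_one_sub_sq_mul_sin_sq (m y : ℝ) :
    1 - m ^ 2 ≤ 1 - m ^ 2 * Real.sin y ^ 2 := by
  nlinarith [mul_le_mul_of_nonneg_left (Real.sin_sq_le_one y) (sq_nonneg m)]

/-- The integrand of `eK` is continuous for moduli less than one. -/
theorem continuous_one_div_sqrt_one_sub_sq_mul_sin_sq {m : ℝ} (hm : m ^ 2 < 1) :
    Continuous fun y : ℝ => 1 / Real.sqrt (1 - m ^ 2 * Real.sin y ^ 2) := by
  refine continuous_const.div (by fun_prop) fun y => ?_
  have := one_sub_sq_le_one_sub_sq_mul_sin_sq m y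
  exact (Real.sqrt_pos.2 (by linarith)).ne'

theorem eK_pos {m : ℝ} (hm : m ^ 2 < 1) : 0 < eK m := by
  refine intervalIntegral.intervalIntegral_pos_of_pos
    ((continuous_one_div_sqrt_one_sub_sq_mul_sin_sq hm).intervalIntegrable _ _)
    (fun y => ?_) (by positivity)
  have := one_sub_sq_le_one_sub_sq_mul_sin_sq m y
  exact one_div_pos.2 (Real.sqrt_pos.2 (by linarith))

theorem one_sub_sq_mul_eK_le {m : ℝ} (hm : m ^ 2 < 1) :
    (1 - m ^ 2) * eK m ≤ π / 2 * √(1 - m ^ 2) := by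
  have hpos : 0 < √(1 - m ^ 2) := Real.sqrt_pos.2 (by linarith)
  have hK : eK m ≤ ∫ _ in (0 : ℝ)..(π / 2), 1 / √(1 - m ^ 2) := by
    refine intervalIntegral.integral_mono_on (by positivity)
      ((continuous_one_div_sqrt_one_sub_sq_mul_sin_sq hm).intervalIntegrable _ _)
      (continuous_const.intervalIntegrable _ _) fun y _ => ?_
    exact one_div_le_one_div_of_le hpos
      (Real.sqrt_le_sqrt (one_sub_sq_le_one_sub_sq_mul_sin_sq m y))
  rw [intervalIntegral.integral_const, smul_eq_mul, sub_zero] at hK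
  calc (1 - m ^ 2) * eK m ≤ (1 - m ^ 2) * (π / 2 * (1 / √(1 - m ^ 2))) :=
        mul_le_mul_of_nonneg_left hK (by linarith)
    _ = π / 2 * ((1 - m ^ 2) / √(1 - m ^ 2)) := by ring
    _ = π / 2 * √(1 - m ^ 2) := by rw [Real.div_sqrt]

theorem one_le_eE {m : ℝ} (hm : m ^ 2 ≤ 1) : 1 ≤ eE m := by
  have hcos : ∫ y in (0 : ℝ)..(π / 2), Real.cos y = 1 := by simp
  rw [← hcos]
  refine intervalIntegral.integral_mono_on (by positivity)
    (Real.continuous_cos.intervalIntegrable _ _)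
    (Continuous.intervalIntegrable (by fun_prop) _ _) fun y _ => ?_
  refine Real.le_sqrt_of_sq_le ?_
  nlinarith [Real.sin_sq_add_cos_sq y, mul_le_mul_of_nonneg_right hm (sq_nonneg (Real.sin y))]

/-- The quotient in `W` is controlled by `(1 - m²) eK(m) ≤ (π / 2) √(1 - m²)`. -/
theorem abs_W_sub_le {m : ℝ} (hm : m ^ 2 < 1) (hb : π / 2 * √(1 - m ^ 2) < 1) :
    |W m - (m ^ 2 + 1) / 2| ≤ π / 2 * √(1 - m ^ 2) / (1 - π / 2 * √(1 - m ^ 2)) := by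
  have hK := eK_pos hm
  have hE := one_le_eE hm.le
  have hx := one_sub_sq_mul_eK_le hm
  have hx0 : 0 ≤ (1 - m ^ 2) * eK m := mul_nonneg (by linarith) hK.le
  have hden : 0 < eE m - (1 - m ^ 2) * eK m := by linarith
  have hW : W m - (m ^ 2 + 1) / 2 =
      -(m ^ 2 * ((1 - m ^ 2) * eK m) / (eE m - (1 - m ^ 2) * eK m)) := by
    have hden' : m ^ 2 - 1 + eE m / eK m = (eE m - (1 - m ^ 2) * eK m) / eK m := by
      field_simp
      ring
    rw [W, hden', div_div_eq_mul_div]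
    ring
  rw [hW, abs_neg, abs_of_nonneg (by positivity)]
  refine div_le_div₀ (by positivity) ?_ (by linarith) (by linarith)
  exact (mul_le_of_le_one_left hx0 hm.le).trans hx

theorem W_tendsto_one_at_left_limit :
    Tendsto W (nhdsWithin 1 (Set.Ioo (0 : ℝ) 1)) (nhds 1) := by
  have hb : Tendsto (fun m : ℝ => π / 2 * √(1 - m ^ 2))
      (nhdsWithin 1 (Set.Ioo (0 : ℝ) 1)) (nhds 0) := by
    have hc : Continuous fun m : ℝ => π / 2 * √(1 - m ^ 2) := by fun_prop
    simpa using (hc.tendsto 1).mono_left nhdsWithin_le_nhds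
  have hbound : Tendsto (fun m : ℝ => π / 2 * √(1 - m ^ 2) / (1 - π / 2 * √(1 - m ^ 2)))
      (nhdsWithin 1 (Set.Ioo (0 : ℝ) 1)) (nhds 0) := by
    have h := hb.div (hb.const_sub 1) (by norm_num)
    rwa [zero_div] at h
  have hdiff : Tendsto (fun m : ℝ => W m - (m ^ 2 + 1) / 2)
      (nhdsWithin 1 (Set.Ioo (0 : ℝ) 1)) (nhds 0) := by
    refine squeeze_zero_norm' ?_ hbound
    filter_upwards [self_mem_nhdsWithin, hb.eventually_lt_const one_pos] with m hm hlt
    exact abs_W_sub_le (by nlinarith [hm.1, hm.2]) hlt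
  have hmain : Tendsto (fun m : ℝ => (m ^ 2 + 1) / 2)
      (nhdsWithin 1 (Set.Ioo (0 : ℝ) 1)) (nhds 1) := by
    have hc : Continuous fun m : ℝ => (m ^ 2 + 1) / 2 := by fun_prop
    have h := (hc.tendsto 1).mono_left (nhdsWithin_le_nhds (s := Set.Ioo (0 : ℝ) 1))
    rwa [show ((1 : ℝ) ^ 2 + 1) / 2 = 1 by norm_num] at h
  simpa using hdiff.add hmain
end
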